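/- Let n ≥ 1 and let c be any fixed n-cycle of {1,…,n}. Then the number of trees T on the vertex set {1,…,n} for which some edge ordering of T has product c equals C(3n−3, n−1)/(2n−1), the (n−1)st Fuss–Catalan number. (Corollary 4.3.) -/

import Mathlib

/-- The transposition of `Sₙ` corresponding to an edge (an unordered pair) of a graph
on the vertex set `Fin n`. -/
def edgePerm {n : ℕ} (e : Sym2 (Fin n)) : Equiv.Perm (Fin n) :=
  Sym2.lift ⟨fun i j => Equiv.swap i j, fun i j => Equiv.swap_comm i j⟩ e

/-- The product of the transpositions of a list of edges, the first edge applied first. -/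
def listProd {n : ℕ} (l : List (Sym2 (Fin n))) : Equiv.Perm (Fin n) :=
  (l.map edgePerm).reverse.prod

/-- `l` is an edge ordering of the graph `T`: a duplicate-free list containing
exactly the edges of `T`. -/
def IsEdgeOrdering {n : ℕ} (T : SimpleGraph (Fin n)) (l : List (Sym2 (Fin n))) : Prop :=
  l.Nodup ∧ ∀ e, e ∈ l ↔ e ∈ T.edgeSet

/-- Ternary trees. -/
inductive TernaryTree : Type
  | leaf : TernaryTree
  | node : TernaryTree → TernaryTree → TernaryTree → TernaryTree

namespace TernaryTree

/-- The number of internal nodes. -/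
def size : TernaryTree → ℕ
  | leaf => 0
  | node l p r => l.size + p.size + r.size + 1

/-- The edges `(u, v)`, `u < v`, of the noncrossing tree on `{a, …, a + t.size}` encoded by `t`,
listed in an order whose product is the cycle `(a, a + 1, …, a + t.size)`. -/
def edges : TernaryTree → ℕ → List (ℕ × ℕ)
  | leaf, _ => []
  | node l p r, a =>
      l.edges a ++ (r.edges (a + l.size + 1 + p.size) ++
        (a, a + l.size + 1 + p.size) :: p.edges (a + l.size + 1))

theorem mem_edges_node {l p r : TernaryTree} {a : ℕ} {e : ℕ × ℕ} :
    e ∈ (node l p r).edges a ↔ e ∈ l.edges a ∨ e ∈ p.edges (a + l.size + 1) ∨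
      e ∈ r.edges (a + l.size + 1 + p.size) ∨ e = (a, a + l.size + 1 + p.size) := by
  simp only [edges, List.mem_append, List.mem_cons]
  tauto

theorem bounds_of_mem_edges {t : TernaryTree} : ∀ {a u v : ℕ}, (u, v) ∈ t.edges a →
    a ≤ u ∧ u < v ∧ v ≤ a + t.size := by
  induction t with
  | leaf => simp [edges]
  | node l p r hl hp hr =>
    intro a u v h
    rw [mem_edges_node, Prod.mk.injEq] at h
    simp only [size]
    rcases h with h | h | h | h
    · have := hl h; omega
    · have := hp h; omega
    · have := hr h; omega
    · omega

theorem length_edges (t : TernaryTree) : ∀ a, (t.edges a).length = t.size := by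
  induction t with
  | leaf => simp [edges, size]
  | node l p r hl hp hr =>
    intro a
    simp only [edges, List.length_append, List.length_cons, hl, hp, hr, size]
    omega

theorem nodup_edges (t : TernaryTree) : ∀ a, (t.edges a).Nodup := by
  induction t with
  | leaf => simp [edges]
  | node l p r hl hp hr =>
    intro a
    simp only [edges, List.nodup_append, List.nodup_cons, hl, hp, hr, List.mem_append,
      List.mem_cons, true_and, and_true]
    refine ⟨⟨fun h => ?_, ?_⟩, ?_⟩
    · have := bounds_of_mem_edges h; omega
    · rintro ⟨u, v⟩ h _ (rfl | h') <;> have := bounds_of_mem_edges h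
      · simp only [ne_eq, Prod.mk.injEq]; omega
      · rintro rfl
        have := bounds_of_mem_edges h'; omega
    · rintro ⟨u, v⟩ h _ (h' | rfl | h') <;> have := bounds_of_mem_edges h
      · rintro rfl
        have := bounds_of_mem_edges h'; omega
      · simp only [ne_eq, Prod.mk.injEq]; omega
      · rintro rfl
        have := bounds_of_mem_edges h'; omega

theorem foldl_swap_edges (t : TernaryTree) : ∀ a x,
    (t.edges a).foldl (fun y e => Equiv.swap e.1 e.2 y) x =
      if a ≤ x ∧ x < a + t.size then x + 1 else if x = a + t.size then a else x := by
  induction t with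
  | leaf =>
    intro a x
    simp only [edges, size, List.foldl_nil, add_zero]
    split_ifs <;> omega
  | node l p r hl hp hr =>
    intro a x
    simp only [edges, List.foldl_append, List.foldl_cons, size]
    have h1 := hl a x
    generalize (l.edges a).foldl _ x = y at h1 ⊢
    have h2 := hr (a + l.size + 1 + p.size) y
    generalize (r.edges (a + l.size + 1 + p.size)).foldl _ y = z at h2 ⊢
    have h3 := Equiv.swap_apply_def a (a + l.size + 1 + p.size) z
    generalize Equiv.swap a (a + l.size + 1 + p.size) z = w at h3 ⊢
    rw [hp]
    clear hl hp hr
    grind (splits := 30)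

theorem exists_edge_of_cut (t : TernaryTree) : ∀ (a : ℕ) (U : Set ℕ) (x y : ℕ), a ≤ x →
    x ≤ a + t.size → a ≤ y → y ≤ a + t.size → x ∈ U → y ∉ U →
    ∃ u v, (u, v) ∈ t.edges a ∧ ¬ (u ∈ U ↔ v ∈ U) := by
  induction t with
  | leaf =>
    intro a U x y hx hx' hy hy' hxU hyU
    simp only [size] at *
    obtain rfl : x = y := by omega
    contradiction
  | node l p r hl hp hr =>
    intro a U x y hx hx' hy hy' hxU hyU
    simp only [size] at *
    by_contra! H
    simp only [mem_edges_node] at H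
    have hl' : ∀ z, a ≤ z → z ≤ a + l.size → (z ∈ U ↔ a ∈ U) := by
      intro z hz hz'
      by_contra hne
      obtain ⟨u, v, h, h'⟩ : ∃ u v, (u, v) ∈ l.edges a ∧ ¬ (u ∈ U ↔ v ∈ U) := by
        by_cases hzU : z ∈ U
        · exact hl a U z a hz hz' le_rfl (by omega) hzU (by tauto)
        · exact hl a U a z le_rfl (by omega) hz hz' (by tauto) hzU
      exact h' (H u v (Or.inl h))
    have hp' : ∀ z, a + l.size + 1 ≤ z → z ≤ a + l.size + 1 + p.size →
        (z ∈ U ↔ a + l.size + 1 + p.size ∈ U) := by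
      intro z hz hz'
      by_contra hne
      obtain ⟨u, v, h, h'⟩ : ∃ u v, (u, v) ∈ p.edges (a + l.size + 1) ∧ ¬ (u ∈ U ↔ v ∈ U) := by
        by_cases hzU : z ∈ U
        · exact hp _ U z _ hz hz' (by omega) le_rfl hzU (by tauto)
        · exact hp _ U _ z (by omega) le_rfl hz hz' (by tauto) hzU
      exact h' (H u v (Or.inr (Or.inl h)))
    have hr' : ∀ z, a + l.size + 1 + p.size ≤ z → z ≤ a + l.size + 1 + p.size + r.size →
        (z ∈ U ↔ a + l.size + 1 + p.size ∈ U) := by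
      intro z hz hz'
      by_contra hne
      obtain ⟨u, v, h, h'⟩ : ∃ u v, (u, v) ∈ r.edges (a + l.size + 1 + p.size) ∧
          ¬ (u ∈ U ↔ v ∈ U) := by
        by_cases hzU : z ∈ U
        · exact hr _ U z _ hz hz' le_rfl (by omega) hzU (by tauto)
        · exact hr _ U _ z le_rfl (by omega) hz hz' (by tauto) hzU
      exact h' (H u v (Or.inr (Or.inr (Or.inl h))))
    have he := H a (a + l.size + 1 + p.size) (by simp)
    have key : ∀ z, a ≤ z → z ≤ a + (l.size + p.size + r.size + 1) → (z ∈ U ↔ a ∈ U) := by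
      intro z hz hz'
      by_cases h1 : z ≤ a + l.size
      · exact hl' z hz h1
      by_cases h2 : z ≤ a + l.size + 1 + p.size
      · exact (hp' z (by omega) h2).trans he.symm
      · exact (hr' z (by omega) (by omega)).trans he.symm
    exact hyU (((key y hy hy').trans (key x hx hx').symm).2 hxU)

theorem edges_injective (t : TernaryTree) : ∀ (t' : TernaryTree) (a : ℕ), t.size = t'.size →
    (∀ u v, (u, v) ∈ t.edges a ↔ (u, v) ∈ t'.edges a) → t = t' := by
  induction t with
  | leaf =>
    intro t' a hs _
    cases t' with
    | leaf => rfl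
    | node => simp [size] at hs
  | node l p r hl hp hr =>
    intro t' a hs h
    cases t' with
    | leaf => simp [size] at hs
    | node l' p' r' =>
    simp only [size] at hs
    simp only [mem_edges_node, Prod.mk.injEq] at h
    have bl := @bounds_of_mem_edges l a
    have bp := @bounds_of_mem_edges p (a + l.size + 1)
    have br := @bounds_of_mem_edges r (a + l.size + 1 + p.size)
    have bl' := @bounds_of_mem_edges l' a
    have bp' := @bounds_of_mem_edges p' (a + l'.size + 1)
    have br' := @bounds_of_mem_edges r' (a + l'.size + 1 + p'.size)
    have hj : l.size + p.size = l'.size + p'.size := by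
      have h1 := (h a (a + l.size + 1 + p.size)).1 (by simp)
      have h2 := (h a (a + l'.size + 1 + p'.size)).2 (by simp)
      grind
    have hi : l.size = l'.size := by
      rcases lt_trichotomy l.size l'.size with hlt | heq | hlt
      · obtain ⟨u, v, huv, hU⟩ := exists_edge_of_cut l' a {x | x ≤ a + l.size} a (a + l'.size)
          le_rfl (by omega) (by omega) le_rfl (by simp) (by simpa using hlt)
        have := (h u v).2 (Or.inl huv)
        grind
      · exact heq
      · obtain ⟨u, v, huv, hU⟩ := exists_edge_of_cut l a {x | x ≤ a + l'.size} a (a + l.size)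
          le_rfl (by omega) (by omega) le_rfl (by simp) (by simpa using hlt)
        have := (h u v).1 (Or.inl huv)
        grind
    have hp_size : p.size = p'.size := by omega
    rw [← hi, ← hp_size] at h bp' br'
    have h1 := hl l' a hi fun u v => by
      have := h u v
      grind
    have h2 := hp p' (a + l.size + 1) hp_size fun u v => by
      have := h u v
      grind
    have h3 := hr r' (a + l.size + 1 + p.size) (by omega) fun u v => by
      have := h u v
      grind
    rw [h1, h2, h3]

end TernaryTree

/-- The relation `E` (relating `u < v`) is a noncrossing tree on the vertex set `{a, …, b}`:
every cut is crossed by an edge, and every edge is the only one crossing some cut. -/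
structure IsNoncrossingTree (a b : ℕ) (E : ℕ → ℕ → Prop) : Prop where
  bounds : ∀ {u v}, E u v → a ≤ u ∧ u < v ∧ v ≤ b
  noncrossing : ∀ {p q r s}, E p q → E r s → p < r → r < q → q < s → False
  exists_edge : ∀ (U : Set ℕ) (x y : ℕ), a ≤ x → x ≤ b → a ≤ y → y ≤ b → x ∈ U → y ∉ U →
    ∃ u v, E u v ∧ ¬ (u ∈ U ↔ v ∈ U)
  exists_cut : ∀ {u v}, E u v → ∃ S : Set ℕ, u ∈ S ∧ v ∉ S ∧
    ∀ u' v', E u' v' → ¬ (u' ∈ S ↔ v' ∈ S) → u' = u ∧ v' = v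

namespace IsNoncrossingTree

variable {a b : ℕ} {E : ℕ → ℕ → Prop}

/-- For the restriction of a noncrossing tree to an interval to be a noncrossing tree, it suffices
that all cuts avoiding a given vertex are crossed. -/
theorem restrict (h : IsNoncrossingTree a b E) {a' b' : ℕ} (c : ℕ)
    (H : ∀ (U : Set ℕ) (x : ℕ), x ∈ U → (∀ z ∈ U, a' ≤ z ∧ z ≤ b') → c ∉ U →
      ∃ u v, E u v ∧ a' ≤ u ∧ v ≤ b' ∧ ¬ (u ∈ U ↔ v ∈ U)) :
    IsNoncrossingTree a' b' fun u v => E u v ∧ a' ≤ u ∧ v ≤ b' where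
  bounds := fun ⟨h1, h2, h3⟩ => ⟨h2, (h.bounds h1).2.1, h3⟩
  noncrossing := fun h1 h2 => h.noncrossing h1.1 h2.1
  exists_edge := by
    intro U x y hx hx' hy hy' hxU hyU
    by_cases hc : c ∈ U
    · obtain ⟨u, v, h1, h2, h3, h4⟩ := H {z | a' ≤ z ∧ z ≤ b' ∧ z ∉ U} y ⟨hy, hy', hyU⟩
        (fun z hz => ⟨hz.1, hz.2.1⟩) (fun hz => hz.2.2 hc)
      refine ⟨u, v, ⟨h1, h2, h3⟩, fun h5 => h4 ?_⟩
      have := h.bounds h1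
      simp only [Set.mem_ofPred_eq, h5]
      constructor <;> rintro ⟨-, -, h6⟩ <;> exact ⟨by omega, by omega, h6⟩
    · obtain ⟨u, v, h1, h2, h3, h4⟩ := H {z | a' ≤ z ∧ z ≤ b' ∧ z ∈ U} x ⟨hx, hx', hxU⟩
        (fun z hz => ⟨hz.1, hz.2.1⟩) (fun hz => hc hz.2.2)
      refine ⟨u, v, ⟨h1, h2, h3⟩, fun h5 => h4 ?_⟩
      have := h.bounds h1
      simp only [Set.mem_ofPred_eq, h5]
      constructor <;> rintro ⟨-, -, h6⟩ <;> exact ⟨by omega, by omega, h6⟩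
  exists_cut := by
    rintro u v ⟨h1, -, -⟩
    obtain ⟨S, h2, h3, h4⟩ := h.exists_cut h1
    exact ⟨S, h2, h3, fun u' v' h5 => h4 u' v' h5.1⟩

/-- If `j` is the largest neighbour of the least vertex `a`, then deleting the edge `{a, j}` leaves
two components that are intervals. -/
theorem exists_split (h : IsNoncrossingTree a b E) {j : ℕ} (hj : E a j)
    (hmax : ∀ k, E a k → k ≤ j) :
    ∃ i, a ≤ i ∧ i < j ∧ ∀ u v, E u v → (u = a ∧ v = j) ∨ v ≤ i ∨ (i < u ∧ v ≤ j) ∨ j ≤ u := by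
  obtain ⟨S, haS, hjS, hS⟩ := h.exists_cut hj
  obtain ⟨-, haj, hjb⟩ := h.bounds hj
  have habove : ∀ x ∈ S, x ≤ b → x < j := by
    intro x hx hxb
    by_contra hxj
    have hne : x ≠ j := fun hh => hjS (hh ▸ hx)
    obtain ⟨u, v, huv, hU⟩ := h.exists_edge {z | z ∈ S ∧ j < z} x a (by omega) hxb le_rfl
      (by omega) ⟨hx, by omega⟩ (fun hh => absurd hh.2 (by omega))
    have h1 := h.bounds huv
    have h2 := h.noncrossing hj huv
    have h3 := hS u v huv
    have h4 := hmax v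
    simp only [Set.mem_ofPred_eq] at hU
    grind
  have hinit : ∀ x ∈ S, x < j → ∀ y, a ≤ y → y < x → y ∈ S := by
    intro x hx hxj y hay hyx
    by_contra hy
    obtain ⟨w, x', hwx, hU⟩ := h.exists_edge {z | z ∈ S ∧ y < z ∧ z < j} x a (by omega) (by omega)
      le_rfl (by omega) ⟨hx, hyx, hxj⟩ (fun hh => absurd hh.2 (by omega))
    have h1 := h.bounds hwx
    have h3 := hS w x' hwx
    have h4 := habove x'
    simp only [Set.mem_ofPred_eq] at hU
    have h5 : w < y ∧ y < x' ∧ x' < j ∧ w ∈ S ∧ x' ∈ S := by grind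
    obtain ⟨u, v, huv, hV⟩ := h.exists_edge {z | z ∉ S ∧ w < z ∧ z < x'} y a (by omega) (by omega)
      le_rfl (by omega) ⟨hy, by omega, by omega⟩ (fun hh => absurd hh.2 (by omega))
    have h6 := h.bounds huv
    have h7 := hS u v huv
    have h8 := h.noncrossing huv hwx
    have h9 := h.noncrossing hwx huv
    simp only [Set.mem_ofPred_eq] at hV
    grind
  classical
  have hi := Nat.findGreatest_spec (P := fun x => x ∈ S) haj.le haS
  have hi' : ∀ x ∈ S, x ≤ j → x ≤ Nat.findGreatest (fun x => x ∈ S) j := fun x hx hxj =>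
    Nat.le_findGreatest hxj hx
  have hij : Nat.findGreatest (fun x => x ∈ S) j ≤ j := Nat.findGreatest_le j
  generalize Nat.findGreatest (fun x => x ∈ S) j = i at hi hi' hij
  have hai := hi' a haS haj.le
  refine ⟨i, hai, by grind, fun u v huv => ?_⟩
  have h1 := h.bounds huv
  have h2 := h.noncrossing hj huv
  have h3 := hS u v huv
  have h4 := hmax v
  grind

theorem exists_ternaryTree (m : ℕ) : ∀ {a : ℕ} {E : ℕ → ℕ → Prop},
    IsNoncrossingTree a (a + m) E →
    ∃ t : TernaryTree, t.size = m ∧ ∀ u v, (u, v) ∈ t.edges a ↔ E u v := by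
  induction m using Nat.strong_induction_on with
  | _ m ih =>
  intro a E h
  rcases Nat.eq_zero_or_pos m with rfl | hm
  · refine ⟨.leaf, rfl, fun u v => ?_⟩
    simp only [TernaryTree.edges, List.not_mem_nil, false_iff]
    intro huv
    have := h.bounds huv
    omega
  obtain ⟨u, k, huk, hU⟩ := h.exists_edge {a} a (a + m) le_rfl (by omega) (by omega) le_rfl rfl
    (by simp; omega)
  obtain rfl : u = a := by
    have := h.bounds huk
    simp only [Set.mem_singleton_iff] at hU
    omega
  classical
  have hj := Nat.findGreatest_spec (P := fun x => E u x) (h.bounds huk).2.2 huk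
  have hmax : ∀ x, E u x → x ≤ Nat.findGreatest (fun x => E u x) (u + m) := fun x hx =>
    Nat.le_findGreatest (h.bounds hx).2.2 hx
  generalize Nat.findGreatest (fun x => E u x) (u + m) = j at hj hmax
  rename' u => a
  obtain ⟨i, hai, hij, hsplit⟩ := h.exists_split hj hmax
  have hjb := (h.bounds hj).2.2
  have h1 : IsNoncrossingTree a i fun u v => E u v ∧ a ≤ u ∧ v ≤ i := by
    refine h.restrict a fun U x hx hU ha => ?_
    obtain ⟨u, v, huv, hne⟩ := h.exists_edge U x a (hU x hx).1 ((hU x hx).2.trans (by omega))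
      le_rfl (by omega) hx ha
    have := h.bounds huv
    have := hsplit u v huv
    have := hU u
    have := hU v
    exact ⟨u, v, huv, by grind, by grind, hne⟩
  have h2 : IsNoncrossingTree (i + 1) j fun u v => E u v ∧ i + 1 ≤ u ∧ v ≤ j := by
    refine h.restrict j fun U x hx hU ha => ?_
    obtain ⟨u, v, huv, hne⟩ := h.exists_edge U x j (by have := hU x hx; omega)
      (by have := hU x hx; omega) (by omega) (by omega) hx ha
    have := h.bounds huv
    have := hsplit u v huv
    have := hU u
    have := hU v
    exact ⟨u, v, huv, by grind, by grind, hne⟩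
  have h3 : IsNoncrossingTree j (a + m) fun u v => E u v ∧ j ≤ u ∧ v ≤ a + m := by
    refine h.restrict j fun U x hx hU ha => ?_
    obtain ⟨u, v, huv, hne⟩ := h.exists_edge U x j (by have := hU x hx; omega)
      (by have := hU x hx; omega) (by omega) (by omega) hx ha
    have := h.bounds huv
    have := hsplit u v huv
    have := hU u
    have := hU v
    exact ⟨u, v, huv, by grind, by grind, hne⟩
  obtain ⟨x, rfl⟩ := Nat.exists_eq_add_of_le hai
  obtain ⟨y, rfl⟩ := Nat.exists_eq_add_of_le (show a + x + 1 ≤ j from hij)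
  obtain ⟨z, hz⟩ := Nat.exists_eq_add_of_le hjb
  rw [hz] at h3
  obtain ⟨l, rfl, hl⟩ := ih x (by omega) h1
  obtain ⟨p, rfl, hp⟩ := ih y (by omega) h2
  obtain ⟨r, rfl, hr⟩ := ih z (by omega) h3
  refine ⟨.node l p r, by simp only [TernaryTree.size]; omega, fun u v => ?_⟩
  rw [TernaryTree.mem_edges_node, hl, hp, hr, Prod.mk.injEq]
  constructor
  · rintro (h | h | h | ⟨rfl, rfl⟩)
    exacts [h.1, h.1, h.1, hj]
  · intro huv
    have := hsplit u v huv
    have := h.bounds huv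
    simp only [huv, true_and]
    omega

end IsNoncrossingTree

open PowerSeries in
/-- The coefficients of the power series solution of `F = 1 + X F ^ 3` satisfy a first-order
linear recurrence. -/
theorem PowerSeries.coeff_succ_of_eq_one_add_X_mul_cube {F : ℚ⟦X⟧} (hF : F = 1 + X * F ^ 3)
    (m : ℕ) : (2 * m + 2) * (2 * m + 3) * coeff (m + 1) F =
      3 * (3 * m + 1) * (3 * m + 2) * coeff m F := by
  set D := derivative ℚ with hD
  have h1 : D F = F ^ 3 + 3 * X * F ^ 2 * D F := by
    conv_lhs => rw [hF]
    simp only [hD, map_add, Derivation.leibniz, Derivation.leibniz_pow, derivative_X, smul_eq_mul,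
      Derivation.map_one_eq_zero, nsmul_eq_mul]
    push_cast
    ring
  have h2 : D (D F) = 6 * F ^ 2 * D F + 6 * X * F * D F ^ 2 + 3 * X * F ^ 2 * D (D F) := by
    conv_lhs => rw [h1]
    have h3 : D (3 : ℚ⟦X⟧) = 0 := by
      simpa using Derivation.map_natCast D 3
    simp only [hD, map_add, Derivation.leibniz, Derivation.leibniz_pow, derivative_X, smul_eq_mul,
      nsmul_eq_mul] at h3 ⊢
    rw [h3]
    push_cast
    ring
  have hu : (1 - 3 * X * F ^ 2 : ℚ⟦X⟧) ≠ 0 := by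
    intro h
    have := congrArg (constantCoeff (R := ℚ)) h
    simp at this
  have key : 4 * (X * D (D F)) + 6 * D F = 27 * (X ^ 2 * D (D F)) + 54 * (X * D F) + 6 * F := by
    refine mul_left_cancel₀ (pow_ne_zero 3 hu) ?_
    have h1' : D F * (1 - 3 * X * F ^ 2) - F ^ 3 = 0 := by linear_combination h1
    have h2' : D (D F) * (1 - 3 * X * F ^ 2) - 6 * F ^ 2 * D F - 6 * X * F * D F ^ 2 = 0 := by
      linear_combination h2
    linear_combination
      (1 - 3 * X * F ^ 2) ^ 2 * (4 * X - 27 * X ^ 2) * h2' +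
      ((6 - 54 * X) * (1 - 3 * X * F ^ 2) ^ 2 + (4 * X - 27 * X ^ 2) *
        (6 * F ^ 2 * (1 - 3 * X * F ^ 2) +
          6 * X * F * (D F * (1 - 3 * X * F ^ 2) + F ^ 3))) * h1' +
      6 * F * (F - X * F ^ 3 + 1) * hF
  have h := congrArg (coeff m) key
  have hC : ∀ (k : ℕ) (G : ℚ⟦X⟧) (j : ℕ), coeff j ((k : ℚ⟦X⟧) * G) = k * coeff j G := by
    intro k G j
    rw [← nsmul_eq_mul, map_nsmul, nsmul_eq_mul]
  have h4 := hC 4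
  have h6 := hC 6
  have h27 := hC 27
  have h54 := hC 54
  push_cast at h4 h6 h27 h54
  simp only [map_add, h4, h6, h27, h54] at h
  rcases m with _ | _ | m
  · simp [hD, coeff_derivative, pow_two, mul_assoc, coeff_zero_X_mul] at h ⊢
    linear_combination 6 * h
  · simp [hD, coeff_derivative, pow_two, mul_assoc, coeff_zero_X_mul, coeff_succ_X_mul] at h ⊢
    linear_combination h
  · simp [hD, coeff_derivative, pow_two, mul_assoc, coeff_succ_X_mul] at h ⊢
    linear_combination h

open PowerSeries in
theorem PowerSeries.coeff_of_eq_one_add_X_mul_cube {F : ℚ⟦X⟧} (hF : F = 1 + X * F ^ 3) (m : ℕ) :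
    (2 * m + 1) * coeff m F = (3 * m).choose m := by
  induction m with
  | zero =>
    rw [hF]
    simp
  | succ m ih =>
    have h := coeff_succ_of_eq_one_add_X_mul_cube hF m
    have hc' : ((2 * m + 1) * ((2 * m + 2) * (m + 1) * ((3 * (m + 1)).choose (m + 1) : ℚ))) =
        (3 * m + 3) * (3 * m + 2) * (3 * m + 1) * ((3 * m).choose m : ℚ) := by
      have e1 := Nat.add_one_mul_choose_eq (3 * m + 2) m
      have e2 := Nat.choose_mul_succ_eq (3 * m + 1) m
      have e3 := Nat.choose_mul_succ_eq (3 * m) m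
      rw [show 3 * m + 1 + 1 - m = 2 * m + 2 by omega] at e2
      rw [show 3 * m + 1 - m = 2 * m + 1 by omega] at e3
      rw [show 3 * (m + 1) = 3 * m + 2 + 1 by ring]
      qify at e1 e2 e3
      linear_combination (-(2 * m + 1) * (2 * m + 2) : ℚ) * e1 -
        (3 * m + 3) * (2 * m + 1) * e2 - (3 * m + 3) * (3 * m + 2) * e3
    have hm : ((2 * m + 1) * ((2 * m + 2) * (m + 1)) : ℚ) ≠ 0 := by positivity
    refine mul_left_cancel₀ hm ?_
    push_cast
    linear_combination (2 * m + 1 : ℚ) * (m + 1) * h - hc' +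
      (3 * m + 3) * (3 * m + 2) * (3 * m + 1) * ih

namespace TernaryTree

open Finset in
open scoped Classical in
/-- The finite set of ternary trees with `m` internal nodes. -/
noncomputable def ofSize : ℕ → Finset TernaryTree
  | 0 => {leaf}
  | m + 1 => (antidiagonal m).attach.biUnion fun x => (antidiagonal x.1.2).attach.biUnion fun y =>
      (ofSize x.1.1 ×ˢ ofSize y.1.1 ×ˢ ofSize y.1.2).image fun t => node t.1 t.2.1 t.2.2
  decreasing_by
    all_goals have hx := HasAntidiagonal.mem_antidiagonal.1 x.2
    · omega
    all_goals
      have hy := HasAntidiagonal.mem_antidiagonal.1 y.2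
      omega

theorem mem_ofSize {t : TernaryTree} : ∀ {m : ℕ}, t ∈ ofSize m ↔ t.size = m := by
  induction t with
  | leaf => rintro (_ | m) <;> simp [ofSize, size]
  | node l p r hl hp hr =>
    rintro (_ | m)
    · simp [ofSize, size]
    · simp only [ofSize, size, Finset.mem_biUnion, Finset.mem_attach, true_and, Finset.mem_image,
        Finset.mem_product, node.injEq, Subtype.exists, Prod.exists,
        Finset.HasAntidiagonal.mem_antidiagonal]
      constructor
      · rintro ⟨i, j, rfl, j', k, rfl, l', p', r', ⟨h1, h2, h3⟩, rfl, rfl, rfl⟩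
        rw [hl.1 h1, hp.1 h2, hr.1 h3]
        ring
      · intro h
        exact ⟨l.size, p.size + r.size, by omega, p.size, r.size, rfl, l, p, r,
          ⟨hl.2 rfl, hp.2 rfl, hr.2 rfl⟩, rfl, rfl, rfl⟩

open Finset in
theorem card_ofSize_succ (m : ℕ) : (ofSize (m + 1)).card =
    ∑ x ∈ antidiagonal m, ∑ y ∈ antidiagonal x.2,
      (ofSize x.1).card * ((ofSize y.1).card * (ofSize y.2).card) := by
  classical
  rw [ofSize, card_biUnion, ← sum_attach (antidiagonal m)]
  · refine sum_congr rfl fun x _ => ?_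
    rw [card_biUnion, ← sum_attach (antidiagonal x.1.2)]
    · refine sum_congr rfl fun y _ => ?_
      rw [card_image_of_injective, card_product, card_product]
      rintro ⟨a, b, c⟩ ⟨a', b', c'⟩ h
      simpa using h
    · rintro ⟨⟨i, j⟩, hy⟩ - ⟨⟨i', j'⟩, hy'⟩ - hne
      simp only [disjoint_left, mem_image, mem_product, mem_ofSize, Prod.exists]
      rintro _ ⟨l, p, r, ⟨h1, h2, h3⟩, rfl⟩ ⟨l', p', r', ⟨h1', h2', h3'⟩, h⟩
      simp only [node.injEq] at h
      obtain ⟨rfl, rfl, rfl⟩ := h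
      simp [← h2, ← h3, h2', h3'] at hne
  · rintro ⟨⟨i, j⟩, hx⟩ - ⟨⟨i', j'⟩, hx'⟩ - hne
    simp only [disjoint_left, mem_biUnion, mem_image, mem_product, mem_ofSize, Prod.exists]
    rintro _ ⟨_, _, l, p, r, ⟨h1, h2, h3⟩, rfl⟩ ⟨_, _, l', p', r', ⟨h1', h2', h3'⟩, h⟩
    simp only [node.injEq] at h
    obtain ⟨rfl, rfl, rfl⟩ := h
    rw [HasAntidiagonal.mem_antidiagonal] at hx hx'
    simp only at hx hx' h1 h1'
    apply hne
    simp only [Subtype.mk.injEq, Prod.mk.injEq]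
    omega

open PowerSeries in
/-- The number of ternary trees with `m` internal nodes is a Fuss–Catalan number. -/
theorem card_ofSize (m : ℕ) : (ofSize m).card = (3 * m).choose m / (2 * m + 1) := by
  have hF : (mk fun m => ((ofSize m).card : ℚ)) =
      1 + X * (mk fun m => ((ofSize m).card : ℚ)) ^ 3 := by
    ext (_ | m)
    · simp [ofSize]
    · rw [map_add, coeff_succ_X_mul, pow_succ', pow_two, coeff_mul]
      simp only [coeff_mul, coeff_mk, card_ofSize_succ, Finset.mul_sum]
      simp [coeff_one]
  have h := PowerSeries.coeff_of_eq_one_add_X_mul_cube hF m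
  rw [coeff_mk] at h
  have h' : (2 * m + 1) * (ofSize m).card = (3 * m).choose m := by exact_mod_cast h
  rw [← h', Nat.mul_div_cancel_left _ (by omega)]

end TernaryTree

section TranspositionProducts

variable {α : Type*} [DecidableEq α]

/-- `w` is a product of `k` permutations of the form `Equiv.swap x y`. -/
def IsSwapProd (k : ℕ) (w : Equiv.Perm α) : Prop :=
  ∃ L : List (α × α), L.length = k ∧ (L.map fun p => Equiv.swap p.1 p.2).prod = w

theorem IsSwapProd.mul {j k : ℕ} {v w : Equiv.Perm α} (hv : IsSwapProd j v)
    (hw : IsSwapProd k w) : IsSwapProd (j + k) (v * w) := by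
  obtain ⟨L, rfl, rfl⟩ := hv
  obtain ⟨M, rfl, rfl⟩ := hw
  exact ⟨L ++ M, by simp, by simp⟩

theorem IsSwapProd.conj {k : ℕ} {w : Equiv.Perm α} (hw : IsSwapProd k w) (g : Equiv.Perm α) :
    IsSwapProd k (g * w * g⁻¹) := by
  obtain ⟨L, rfl, rfl⟩ := hw
  refine ⟨L.map fun p => (g p.1, g p.2), by simp, ?_⟩
  induction L with
  | nil => simp
  | cons p L ih =>
    simp only [List.map_cons, List.prod_cons, ih]
    rw [← mul_assoc g (Equiv.swap p.1 p.2), Equiv.mul_swap_eq_swap_mul]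
    simp only [mul_assoc]

/-- A product of `k` transpositions acting transitively on `n` points satisfies `n ≤ k + 1`. -/
theorem IsSwapProd.card_le [Finite α] [Nonempty α] {k : ℕ} {w : Equiv.Perm α}
    (hw : IsSwapProd k w)
    (htrans : ∀ U : Set α, (∀ x, w x ∈ U ↔ x ∈ U) → U.Nonempty → U = Set.univ) :
    Nat.card α ≤ k + 1 := by
  obtain ⟨L, rfl, rfl⟩ := hw
  let S : Finset (Sym2 α) := (L.map fun p => s(p.1, p.2)).toFinset
  let G := SimpleGraph.fromEdgeSet (S : Set (Sym2 α))
  have hreach : ∀ M : List (α × α), (∀ p ∈ M, p ∈ L) → ∀ x,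
      G.Reachable ((M.map fun p => Equiv.swap p.1 p.2).prod x) x := by
    intro M hM x
    induction M with
    | nil => simp
    | cons p M ih =>
      have ih := ih fun q hq => hM q (List.mem_cons_of_mem _ hq)
      rw [List.map_cons, List.prod_cons, Equiv.Perm.mul_apply]
      generalize (M.map fun p => Equiv.swap p.1 p.2).prod x = y at ih
      refine SimpleGraph.Reachable.trans ?_ ih
      have hmem : s(p.1, p.2) ∈ (S : Set (Sym2 α)) := by
        rw [Finset.mem_coe, List.mem_toFinset]
        exact List.mem_map_of_mem (hM p List.mem_cons_self)
      have hp : G.Reachable p.1 p.2 := by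
        by_cases hne : p.1 = p.2
        · rw [hne]
        · exact SimpleGraph.Adj.reachable ((SimpleGraph.fromEdgeSet_adj _).2 ⟨hmem, hne⟩)
      rw [Equiv.swap_apply_def]
      split_ifs with h1 h2
      · rw [h1]; exact hp.symm
      · rw [h2]; exact hp
      · rfl
  have hconn : G.Connected := by
    refine { preconnected := fun x y => ?_, nonempty := inferInstance }
    have hU := htrans {z | G.Reachable z x} (fun z =>
      ⟨fun h => (hreach L (fun _ => id) z).symm.trans h,
        fun h => (hreach L (fun _ => id) z).trans h⟩)
      ⟨x, SimpleGraph.Reachable.refl x⟩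
    have : y ∈ {z | G.Reachable z x} := hU ▸ Set.mem_univ y
    exact SimpleGraph.Reachable.symm this
  refine hconn.card_vert_le_card_edgeSet_add_one.trans (Nat.add_le_add_right ?_ 1)
  calc Nat.card G.edgeSet ≤ Nat.card (S : Set (Sym2 α)) :=
        Nat.card_mono S.finite_toSet (by
          rw [SimpleGraph.edgeSet_fromEdgeSet]
          exact Set.sdiff_subset)
    _ ≤ L.length := by
      rw [Nat.card_coe_set_eq, Set.ncard_coe_finset]
      exact (List.toFinset_card_le _).trans (by simp)

end TranspositionProducts

section EdgeOrderings

variable {n : ℕ}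

theorem listProd_cons (e : Sym2 (Fin n)) (l : List (Sym2 (Fin n))) :
    listProd (e :: l) = listProd l * edgePerm e := by
  simp [listProd]

theorem listProd_append (l l' : List (Sym2 (Fin n))) :
    listProd (l ++ l') = listProd l' * listProd l := by
  simp [listProd]

theorem edgePerm_mk (x y : Fin n) : edgePerm s(x, y) = Equiv.swap x y := rfl

theorem edgePerm_inv (e : Sym2 (Fin n)) : (edgePerm e)⁻¹ = edgePerm e := by
  induction e with
  | _ x y => exact Equiv.swap_inv x y

theorem isSwapProd_listProd (l : List (Sym2 (Fin n))) : IsSwapProd l.length (listProd l) := by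
  induction l with
  | nil => exact ⟨[], rfl, rfl⟩
  | cons e l ih =>
    rw [listProd_cons]
    refine ih.mul ?_
    induction e with
    | _ x y => exact ⟨[(x, y)], rfl, by simp [edgePerm_mk]⟩

theorem isSwapProd_mul_listProd (x y z : List (Sym2 (Fin n))) (e f : Sym2 (Fin n)) :
    IsSwapProd (x.length + y.length + z.length)
      (edgePerm e * edgePerm f * listProd (x ++ e :: (y ++ f :: z))) := by
  have h := (((isSwapProd_listProd z).conj (edgePerm e * edgePerm f)).mul
    ((isSwapProd_listProd y).conj (edgePerm e))).mul (isSwapProd_listProd x)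
  convert h using 1
  · ring
  · simp only [listProd_append, listProd_cons, mul_inv_rev, edgePerm_inv]
    have he : edgePerm e * edgePerm e = 1 := by
      nth_rewrite 1 [← edgePerm_inv]
      exact inv_mul_cancel _
    simp only [mul_assoc]
    rw [← mul_assoc (edgePerm e) (edgePerm e), he, one_mul]

theorem IsEdgeOrdering.length_eq {T : SimpleGraph (Fin n)} {l : List (Sym2 (Fin n))}
    (h : IsEdgeOrdering T l) : l.length = Nat.card T.edgeSet := by
  classical
  rw [← List.toFinset_card_of_nodup h.1, ← Set.ncard_coe_finset, Nat.card_coe_set_eq]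
  congr 1
  ext e
  simp [h.2 e]

end EdgeOrderings

/-- If `(p, q)` and `(r, s)` cross, then multiplying the cycle `x ↦ x + 1` of `{0, …, m}` by both
transpositions results in a transitive permutation. -/
theorem iff_of_crossing {m p q r s : ℕ} (hpr : p < r) (hrq : r < q) (hqs : q < s) (hs : s ≤ m)
    {P : ℕ → Prop}
    (hP : ∀ x ≤ m, P (Equiv.swap p q (Equiv.swap r s (if x = m then 0 else x + 1))) ↔ P x) :
    ∀ x ≤ m, P x ↔ P m := by
  have step : ∀ x, x < m → x + 1 ≠ p → x + 1 ≠ q → x + 1 ≠ r → x + 1 ≠ s → (P (x + 1) ↔ P x) := by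
    intro x hx h1 h2 h3 h4
    have := hP x hx.le
    rwa [if_neg hx.ne, Equiv.swap_apply_of_ne_of_ne h3 h4,
      Equiv.swap_apply_of_ne_of_ne h1 h2] at this
  have block : ∀ a b, a ≤ b → b ≤ m → (∀ x, a < x → x ≤ b → x ≠ p ∧ x ≠ q ∧ x ≠ r ∧ x ≠ s) →
      (P b ↔ P a) := by
    intro a b hab
    induction b, hab using Nat.le_induction with
    | base => intros; rfl
    | succ b hab ih =>
      intro hb hx
      have h := hx (b + 1) (by omega) le_rfl
      exact (step b (by omega) h.1 h.2.1 h.2.2.1 h.2.2.2).trans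
        (ih (by omega) fun x h1 h2 => hx x h1 (by omega))
  have hq : P p ↔ P (q - 1) := by
    have := hP (q - 1) (by omega)
    rwa [if_neg (by omega), Nat.sub_add_cancel (by omega),
      Equiv.swap_apply_of_ne_of_ne (x := q) (by omega) (by omega), Equiv.swap_apply_right] at this
  have hr : P s ↔ P (r - 1) := by
    have := hP (r - 1) (by omega)
    rwa [if_neg (by omega), Nat.sub_add_cancel (by omega), Equiv.swap_apply_left,
      Equiv.swap_apply_of_ne_of_ne (by omega) (by omega)] at this
  have hs' : P r ↔ P (s - 1) := by
    have := hP (s - 1) (by omega)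
    rwa [if_neg (by omega), Nat.sub_add_cancel (by omega), Equiv.swap_apply_right,
      Equiv.swap_apply_of_ne_of_ne (by omega) (by omega)] at this
  have h1 : ∀ x, s ≤ x → x ≤ m → (P x ↔ P s) := fun x h h' =>
    block s x h h' (by intros; omega)
  have h2 : ∀ x, q ≤ x → x < s → (P x ↔ P q) := fun x h h' =>
    block q x h (by omega) (by intros; omega)
  have h3 : ∀ x, r ≤ x → x < q → (P x ↔ P r) := fun x h h' =>
    block r x h (by omega) (by intros; omega)
  have h4 : ∀ x, p ≤ x → x < r → (P x ↔ P p) := fun x h h' =>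
    block p x h (by omega) (by intros; omega)
  have h5 : ∀ x, x < p → (P x ↔ P m) := by
    intro x hx
    have h0 := hP m le_rfl
    rw [if_pos rfl, Equiv.swap_apply_of_ne_of_ne (x := 0) (by omega) (by omega),
      Equiv.swap_apply_of_ne_of_ne (by omega) (by omega)] at h0
    exact (block 0 x (by omega) (by omega) (by intros; omega)).trans h0
  have hpm : P p ↔ P m :=
    (h4 (r - 1) (by omega) (by omega)).symm.trans (hr.symm.trans (h1 m hs le_rfl).symm)
  have hrm : P r ↔ P m := (h3 (q - 1) (by omega) (by omega)).symm.trans (hq.symm.trans hpm)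
  have hqm : P q ↔ P m := (h2 (s - 1) (by omega) (by omega)).symm.trans (hs'.symm.trans hrm)
  intro x hx
  by_cases c1 : x < p
  · exact h5 x c1
  by_cases c2 : x < r
  · exact (h4 x (by omega) c2).trans hpm
  by_cases c3 : x < q
  · exact (h3 x (by omega) c3).trans hrm
  by_cases c4 : x < s
  · exact (h2 x (by omega) c4).trans hqm
  · exact (h1 x (by omega) hx).trans (h1 m hs le_rfl).symm

/-- The edges of a tree with an ordering whose product is the standard cycle do not cross. -/
theorem not_crossing_of_listProd_eq_finRotate {m : ℕ} {l : List (Sym2 (Fin (m + 1)))}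
    (hl : l.length = m) (hprod : listProd l = finRotate (m + 1)) {p q r s : Fin (m + 1)}
    (he : s(p, q) ∈ l) (hf : s(r, s) ∈ l) (hpr : p < r) (hrq : r < q) (hqs : q < s) : False := by
  have hcomm : Equiv.swap r s * Equiv.swap p q = Equiv.swap p q * Equiv.swap r s := by
    refine (Equiv.Perm.Disjoint.commute ?_).eq
    intro x
    simp only [Equiv.swap_apply_def]
    grind
  have key : IsSwapProd (m - 2) (Equiv.swap p q * Equiv.swap r s * finRotate (m + 1)) ∧ 2 ≤ m := by
    obtain ⟨x, y, rfl⟩ := List.append_of_mem he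
    have hne : s(r, s) ≠ s(p, q) := by
      intro h
      rw [Sym2.eq_iff] at h
      grind
    rcases List.mem_append.1 hf with hf | hf
    · obtain ⟨x, z, rfl⟩ := List.append_of_mem hf
      have h := isSwapProd_mul_listProd x z y s(r, s) s(p, q)
      simp only [List.append_assoc, List.cons_append, List.length_append,
        List.length_cons] at hl hprod
      rw [hprod, edgePerm_mk, edgePerm_mk, hcomm] at h
      exact ⟨by convert h using 1; omega, by omega⟩
    · rw [List.mem_cons, or_iff_right hne] at hf
      obtain ⟨y, z, rfl⟩ := List.append_of_mem hf
      have h := isSwapProd_mul_listProd x y z s(p, q) s(r, s)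
      simp only [List.length_append, List.length_cons] at hl
      rw [hprod, edgePerm_mk, edgePerm_mk] at h
      exact ⟨by convert h using 1; omega, by omega⟩
  have := key.1.card_le fun U hU hne => by
    have h : ∀ x ≤ m, (∃ z ∈ U, (z : ℕ) = x) ↔ ∃ z ∈ U, (z : ℕ) = m := by
      refine iff_of_crossing (p := p) (q := q) (r := r) (s := s) hpr hrq hqs
        (Nat.le_of_lt_succ s.2) (P := fun x => ∃ z ∈ U, (z : ℕ) = x) fun x hx => ?_
      have h1 := hU ⟨x, Nat.lt_succ_of_le hx⟩
      have h2 : ((Equiv.swap p q * Equiv.swap r s * finRotate (m + 1)) ⟨x, Nat.lt_succ_of_le hx⟩ :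
          ℕ) = Equiv.swap (p : ℕ) q (Equiv.swap (r : ℕ) s (if x = m then 0 else x + 1)) := by
        simp only [Equiv.Perm.mul_apply]
        rw [← Fin.val_injective.swap_apply, ← Fin.val_injective.swap_apply, coe_finRotate]
        simp [Fin.ext_iff]
      rw [← h2]
      simp only [Fin.val_inj, exists_eq_right, h1]
      constructor
      · intro h; exact ⟨_, h, rfl⟩
      · rintro ⟨z, hz, rfl⟩; exact hz
    obtain ⟨y, hy⟩ := hne
    have hm := (h y (Nat.le_of_lt_succ y.2)).1 ⟨y, hy, rfl⟩
    ext z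
    obtain ⟨z', hz', h3⟩ := (h z (Nat.le_of_lt_succ z.2)).2 hm
    simpa [← Fin.ext h3] using hz'
  rw [Nat.card_fin] at this
  omega

theorem isNoncrossingTree_of_listProd_eq_finRotate {m : ℕ} {T : SimpleGraph (Fin (m + 1))}
    (hT : T.IsTree) {l : List (Sym2 (Fin (m + 1)))} (hl : IsEdgeOrdering T l)
    (hprod : listProd l = finRotate (m + 1)) :
    IsNoncrossingTree 0 (0 + m) fun u v =>
      ∃ x y : Fin (m + 1), x < y ∧ T.Adj x y ∧ (x : ℕ) = u ∧ (y : ℕ) = v where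
  bounds := by
    rintro _ _ ⟨x, y, hxy, -, rfl, rfl⟩
    exact ⟨Nat.zero_le _, hxy, by omega⟩
  noncrossing := by
    rintro _ _ _ _ ⟨p, q, -, hpq, rfl, rfl⟩ ⟨r, s, -, hrs, rfl, rfl⟩ hpr hrq hqs
    have hm : l.length = m := by
      have := (SimpleGraph.isTree_iff_connected_and_card.1 hT).2
      rw [Nat.card_fin] at this
      rw [hl.length_eq]
      omega
    exact not_crossing_of_listProd_eq_finRotate hm hprod ((hl.2 s(p, q)).2 hpq)
      ((hl.2 s(r, s)).2 hrs) hpr hrq hqs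
  exists_edge := by
    intro U x y _ hx _ hy hxU hyU
    obtain ⟨w⟩ := hT.connected.preconnected ⟨x, by omega⟩ ⟨y, by omega⟩
    obtain ⟨d, -, h1, h2⟩ := w.exists_boundary_dart {z | (z : ℕ) ∈ U} hxU hyU
    rw [Set.mem_ofPred_eq] at h1 h2
    rcases lt_or_gt_of_ne d.adj.ne with h | h
    · exact ⟨_, _, ⟨_, _, h, d.adj, rfl, rfl⟩, by tauto⟩
    · exact ⟨_, _, ⟨_, _, h, d.adj.symm, rfl, rfl⟩, by tauto⟩
  exists_cut := by
    rintro _ _ ⟨x, y, hxy, hadj, rfl, rfl⟩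
    have hbridge := SimpleGraph.isBridge_iff.1
      (SimpleGraph.isAcyclic_iff_forall_adj_isBridge.1 hT.isAcyclic hadj)
    refine ⟨{n | ∃ z : Fin (m + 1), (z : ℕ) = n ∧ (T.deleteEdges {s(x, y)}).Reachable x z},
      ⟨x, rfl, SimpleGraph.Reachable.refl x⟩, ?_, ?_⟩
    · rintro ⟨z, hz, h⟩
      exact hbridge (Fin.ext hz ▸ h)
    · rintro _ _ ⟨p, q, hpq, hadj', rfl, rfl⟩ h
      simp only [Set.mem_ofPred_eq, Fin.val_inj, exists_eq_left] at h ⊢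
      by_contra hne
      refine h ?_
      have hdel : (T.deleteEdges {s(x, y)}).Adj p q := by
        rw [SimpleGraph.deleteEdges_adj]
        refine ⟨hadj', fun h => ?_⟩
        rw [Set.mem_singleton_iff, Sym2.eq_iff] at h
        grind
      exact ⟨fun h => h.trans hdel.reachable, fun h => h.trans hdel.symm.reachable⟩

namespace TernaryTree

/-- The noncrossing tree on `{0, …, m}` corresponding to a ternary tree of size `m`. -/
def toGraph (m : ℕ) (t : TernaryTree) : SimpleGraph (Fin (m + 1)) where
  Adj x y := ((x : ℕ), (y : ℕ)) ∈ t.edges 0 ∨ ((y : ℕ), (x : ℕ)) ∈ t.edges 0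
  symm := ⟨fun _ _ h => h.symm⟩
  loopless := ⟨fun x h => by
    rcases h with h | h <;> exact lt_irrefl _ (bounds_of_mem_edges h).2.1⟩

variable {m : ℕ} {t : TernaryTree}

theorem toGraph_adj {x y : Fin (m + 1)} : (t.toGraph m).Adj x y ↔
    ((x : ℕ), (y : ℕ)) ∈ t.edges 0 ∨ ((y : ℕ), (x : ℕ)) ∈ t.edges 0 := Iff.rfl

theorem connected_toGraph (ht : t.size = m) : (t.toGraph m).Connected := by
  refine { preconnected := fun x y => ?_, nonempty := inferInstance }
  by_contra hxy
  obtain ⟨u, v, huv, h⟩ := t.exists_edge_of_cut 0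
    {n | ∃ z : Fin (m + 1), (z : ℕ) = n ∧ (t.toGraph m).Reachable x z} x y
    (Nat.zero_le _) (by omega) (Nat.zero_le _) (by omega) ⟨x, rfl, SimpleGraph.Reachable.refl x⟩
    (by
      rintro ⟨z, hz, h⟩
      exact hxy (Fin.ext hz ▸ h))
  have hb := bounds_of_mem_edges huv
  lift u to Fin (m + 1) using by omega
  lift v to Fin (m + 1) using by omega
  have hadj : (t.toGraph m).Adj u v := Or.inl huv
  simp only [Set.mem_ofPred_eq, Fin.val_inj, exists_eq_left] at h
  exact h ⟨fun h => h.trans hadj.reachable, fun h => h.trans hadj.symm.reachable⟩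

/-- The edge ordering of `t.toGraph m` in which `t.edges 0` lists the edges. -/
def edgeList (m : ℕ) (t : TernaryTree) : List (Sym2 (Fin (m + 1))) :=
  (t.edges 0).map fun e => s(Fin.ofNat (m + 1) e.1, Fin.ofNat (m + 1) e.2)

theorem val_ofNat_of_mem_edges (ht : t.size = m) {u v : ℕ} (h : (u, v) ∈ t.edges 0) :
    (Fin.ofNat (m + 1) u : ℕ) = u ∧ (Fin.ofNat (m + 1) v : ℕ) = v := by
  have := bounds_of_mem_edges h
  exact ⟨Nat.mod_eq_of_lt (by omega), Nat.mod_eq_of_lt (by omega)⟩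

theorem isEdgeOrdering_edgeList (ht : t.size = m) :
    IsEdgeOrdering (t.toGraph m) (t.edgeList m) := by
  constructor
  · refine List.Nodup.map_on ?_ (t.nodup_edges 0)
    rintro ⟨u, v⟩ h ⟨u', v'⟩ h' heq
    have h1 := val_ofNat_of_mem_edges ht h
    have h2 := val_ofNat_of_mem_edges ht h'
    have h3 := (bounds_of_mem_edges h).2.1
    have h4 := (bounds_of_mem_edges h').2.1
    rw [Sym2.eq_iff] at heq
    simp only [Fin.ext_iff, h1, h2] at heq
    rw [Prod.mk.injEq]
    omega
  · intro e
    induction e with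
    | _ x y =>
      rw [SimpleGraph.mem_edgeSet, toGraph_adj, edgeList, List.mem_map]
      constructor
      · rintro ⟨⟨u, v⟩, h, heq⟩
        have h1 := val_ofNat_of_mem_edges ht h
        rw [Sym2.eq_iff] at heq
        simp only [Fin.ext_iff, h1] at heq
        rcases heq with ⟨rfl, rfl⟩ | ⟨rfl, rfl⟩
        · exact Or.inl h
        · exact Or.inr h
      · rintro (h | h)
        · exact ⟨_, h, by simp⟩
        · exact ⟨_, h, by simp [Sym2.eq_swap]⟩

theorem isTree_toGraph (ht : t.size = m) : (t.toGraph m).IsTree := by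
  rw [SimpleGraph.isTree_iff_connected_and_card]
  refine ⟨connected_toGraph ht, ?_⟩
  rw [← (isEdgeOrdering_edgeList ht).length_eq, edgeList, List.length_map, length_edges, ht,
    Nat.card_fin]

theorem listProd_edgeList (ht : t.size = m) : listProd (t.edgeList m) = finRotate (m + 1) := by
  have key : ∀ (L : List (ℕ × ℕ)), (∀ e ∈ L, e ∈ t.edges 0) → ∀ x : Fin (m + 1),
      (listProd (L.map fun e => s(Fin.ofNat (m + 1) e.1, Fin.ofNat (m + 1) e.2)) x : ℕ) =
        L.foldl (fun (y : ℕ) e => Equiv.swap e.1 e.2 y) (x : ℕ) := by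
    intro L
    induction L with
    | nil => intro _ x; rfl
    | cons e L ih =>
      intro hL x
      have h := val_ofNat_of_mem_edges ht (hL e List.mem_cons_self)
      rw [List.map_cons, listProd_cons, Equiv.Perm.mul_apply,
        ih fun e he => hL e (List.mem_cons_of_mem _ he), List.foldl_cons, edgePerm_mk,
        ← Fin.val_injective.swap_apply, h.1, h.2]
  ext x
  rw [edgeList, key _ fun _ => id, foldl_swap_edges, coe_finRotate, ht]
  simp only [Fin.ext_iff, Fin.val_last]
  split_ifs <;> omega

theorem toGraph_injOn (m : ℕ) : Set.InjOn (toGraph m) {t | t.size = m} := by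
  have key : ∀ t t' : TernaryTree, t.size = m → t.toGraph m = t'.toGraph m →
      ∀ u v, (u, v) ∈ t.edges 0 → (u, v) ∈ t'.edges 0 := by
    intro t t' ht h u v huv
    have hb := bounds_of_mem_edges huv
    lift u to Fin (m + 1) using by omega
    lift v to Fin (m + 1) using by omega
    have hadj : (t.toGraph m).Adj u v := Or.inl huv
    rw [h] at hadj
    refine hadj.resolve_right fun h' => ?_
    have := bounds_of_mem_edges h'
    omega
  intro t ht t' ht' h
  exact edges_injective t t' 0 (ht.trans ht'.symm) fun u v =>
    ⟨key t t' ht h u v, key t' t ht' h.symm u v⟩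

end TernaryTree

/-- The trees on `Fin n` admitting an edge ordering with product `c`. -/
def treesWithProd {n : ℕ} (c : Equiv.Perm (Fin n)) : Set (SimpleGraph (Fin n)) :=
  {T | T.IsTree ∧ ∃ l, IsEdgeOrdering T l ∧ listProd l = c}

theorem treesWithProd_finRotate (m : ℕ) :
    treesWithProd (finRotate (m + 1)) =
      TernaryTree.toGraph m '' (TernaryTree.ofSize m : Set TernaryTree) := by
  ext T
  constructor
  · rintro ⟨hT, l, hl, hprod⟩
    obtain ⟨t, ht, h⟩ :=
      (isNoncrossingTree_of_listProd_eq_finRotate hT hl hprod).exists_ternaryTree m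
    refine ⟨t, Finset.mem_coe.2 (TernaryTree.mem_ofSize.2 ht), ?_⟩
    ext x y
    simp only [TernaryTree.toGraph_adj, h, Fin.val_inj]
    constructor
    · rintro (⟨x, y, -, hadj, rfl, rfl⟩ | ⟨x, y, -, hadj, rfl, rfl⟩)
      · exact hadj
      · exact hadj.symm
    · intro hadj
      rcases lt_or_gt_of_ne hadj.ne with hlt | hlt
      · exact Or.inl ⟨x, y, hlt, hadj, rfl, rfl⟩
      · exact Or.inr ⟨y, x, hlt, hadj.symm, rfl, rfl⟩
  · rintro ⟨t, ht, rfl⟩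
    have ht := TernaryTree.mem_ofSize.1 (Finset.mem_coe.1 ht)
    exact ⟨TernaryTree.isTree_toGraph ht, _, TernaryTree.isEdgeOrdering_edgeList ht,
      TernaryTree.listProd_edgeList ht⟩

theorem ncard_treesWithProd_finRotate (m : ℕ) :
    (treesWithProd (finRotate (m + 1))).ncard = (3 * m).choose m / (2 * m + 1) := by
  rw [treesWithProd_finRotate, Set.InjOn.ncard_image, Set.ncard_coe_finset,
    TernaryTree.card_ofSize]
  exact (TernaryTree.toGraph_injOn m).mono fun t ht => TernaryTree.mem_ofSize.1 ht

section Conjugation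

variable {n : ℕ}

theorem edgePerm_map (σ : Equiv.Perm (Fin n)) (e : Sym2 (Fin n)) :
    edgePerm (e.map σ) = σ * edgePerm e * σ⁻¹ := by
  induction e with
  | _ x y => rw [Sym2.map_mk, edgePerm_mk, edgePerm_mk, Equiv.mul_swap_eq_swap_mul,
      mul_inv_cancel_right]

theorem listProd_map (σ : Equiv.Perm (Fin n)) (l : List (Sym2 (Fin n))) :
    listProd (l.map (Sym2.map σ)) = σ * listProd l * σ⁻¹ := by
  induction l with
  | nil => simp [listProd]
  | cons e l ih => simp [listProd_cons, ih, edgePerm_map, mul_assoc]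

theorem IsEdgeOrdering.map {T : SimpleGraph (Fin n)} {l : List (Sym2 (Fin n))}
    (h : IsEdgeOrdering T l) (σ : Equiv.Perm (Fin n)) :
    IsEdgeOrdering (T.map σ) (l.map (Sym2.map σ)) := by
  refine ⟨h.1.map (Sym2.map.injective σ.injective), fun e => ?_⟩
  have : (T.map σ).edgeSet = Sym2.map σ '' T.edgeSet :=
    SimpleGraph.edgeSet_map σ.toEmbedding T
  simp [this, h.2]

theorem ncard_treesWithProd_le_conj (c σ : Equiv.Perm (Fin n)) :
    (treesWithProd c).ncard ≤ (treesWithProd (σ * c * σ⁻¹)).ncard := by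
  refine Set.ncard_le_ncard_of_injOn (SimpleGraph.map σ) ?_
    (SimpleGraph.map_injective σ.toEmbedding).injOn
  rintro T ⟨hT, l, hl, rfl⟩
  exact ⟨(SimpleGraph.Iso.map σ T).isTree_iff.1 hT, _, hl.map σ, listProd_map σ l⟩

theorem ncard_treesWithProd_eq_of_isConj {c d : Equiv.Perm (Fin n)} (h : IsConj c d) :
    (treesWithProd c).ncard = (treesWithProd d).ncard := by
  have key : ∀ {c d : Equiv.Perm (Fin n)}, IsConj c d →
      (treesWithProd c).ncard ≤ (treesWithProd d).ncard := by
    intro c d h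
    obtain ⟨σ, rfl⟩ := isConj_iff.1 h
    exact ncard_treesWithProd_le_conj c σ
  exact le_antisymm (key h) (key h.symm)

theorem isConj_finRotate {m : ℕ} {c : Equiv.Perm (Fin (m + 1))}
    (hc : ∀ x y, ∃ k : ℕ, (c ^ k) x = y) : IsConj c (finRotate (m + 1)) := by
  cases m with
  | zero =>
    have : c = finRotate (0 + 1) := by
      ext x
      omega
    rw [this]
  | succ m =>
    have hne : ∀ x, c x ≠ x := by
      intro x hx
      obtain ⟨y, hy⟩ := exists_ne x
      obtain ⟨k, hk⟩ := hc x y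
      exact hy (hk ▸ Equiv.Perm.pow_apply_eq_self_of_apply_eq_self hx k)
    have hcycle : c.IsCycle :=
      ⟨0, hne 0, fun y _ => by
        obtain ⟨k, hk⟩ := hc 0 y
        exact ⟨k, by rwa [zpow_natCast]⟩⟩
    refine hcycle.isConj isCycle_finRotate ?_
    have hsupp : c.support = Finset.univ := by
      ext x
      simp [hne x]
    rw [hsupp, support_finRotate]

end Conjugation

/-- Corollary 4.3: for `n ≥ 1` and any fixed `n`-cycle `c` (a
permutation whose powers act transitively on `{1,…,n}`), the number of trees on
`{1,…,n}` some edge ordering of which has product `c` equals the Fuss–Catalan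
number `C(3n-3, n-1) / (2n-1)`. -/
theorem stmt19 (n : ℕ) (hn : 1 ≤ n) (c : Equiv.Perm (Fin n))
    (hc : ∀ x y : Fin n, ∃ k : ℕ, (c ^ k) x = y) :
    {T : SimpleGraph (Fin n) |
        T.IsTree ∧ ∃ l, IsEdgeOrdering T l ∧ listProd l = c}.ncard
      = Nat.choose (3 * n - 3) (n - 1) / (2 * n - 1) := by
  obtain ⟨m, rfl⟩ := Nat.exists_eq_add_of_le' hn
  have h := (ncard_treesWithProd_eq_of_isConj (isConj_finRotate hc)).trans
    (ncard_treesWithProd_finRotate m)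
  rw [show 3 * (m + 1) - 3 = 3 * m by omega, Nat.add_sub_cancel,
    show 2 * (m + 1) - 1 = 2 * m + 1 by omega]
  exact h
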